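/- arXiv:2001.03316 — 7 statements merged into one kernel-verified Lean document; each statement's English description precedes it below -/
import Mathlib

section
/- Let E be a real inner product space, let n ≥ 1, and let f₁, …, fₙ : E → ℝ be convex differentiable functions with gradients ∇fᵢ. Suppose the sum F(w) = Σᵢ₌₁ⁿ fᵢ(w) is λ-strongly convex in the sense that ⟨∇F(w) − ∇F(v), w − v⟩ ≥ λ‖w − v‖² for all w, v, with λ > 0, and suppose w* satisfies ∇fᵢ(w*) = 0 for every i. Then for every w ∈ E and every choice of weights p₁, …, pₙ with pᵢ ≥ p_min > 0 for all i, one has ⟨Σᵢ₌₁ⁿ pᵢ ∇fᵢ(w), w − w*⟩ ≥ p_min · λ · ‖w − w*‖². -/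
open RealInnerProductSpace Finset

/-- The gradient of a convex function is a monotone operator. -/
theorem ConvexOn.inner_gradient_sub_nonneg
    {E : Type*} [NormedAddCommGroup E] [InnerProductSpace ℝ E]
    {f : E → ℝ} (hf : ConvexOn ℝ Set.univ f) {x y a b : E}
    (hx : HasFDerivAt f (innerSL ℝ a) x) (hy : HasFDerivAt f (innerSL ℝ b) y) :
    0 ≤ ⟪a - b, x - y⟫ := by
  have hφ : ConvexOn ℝ Set.univ (f ∘ AffineMap.lineMap (k := ℝ) y x) := by
    simpa using hf.comp_affineMap (AffineMap.lineMap (k := ℝ) y x)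
  have h₀ : HasDerivAt (f ∘ AffineMap.lineMap (k := ℝ) y x) ⟪b, x - y⟫ 0 :=
    HasFDerivAt.comp_hasDerivAt (0 : ℝ) (l' := innerSL ℝ b) (by simpa using hy)
      AffineMap.hasDerivAt_lineMap
  have h₁ : HasDerivAt (f ∘ AffineMap.lineMap (k := ℝ) y x) ⟪a, x - y⟫ 1 :=
    HasFDerivAt.comp_hasDerivAt (1 : ℝ) (l' := innerSL ℝ a) (by simpa using hx)
      AffineMap.hasDerivAt_lineMap
  rw [inner_sub_left, sub_nonneg]
  exact (hφ.le_slope_of_hasDerivAt (Set.mem_univ _) (Set.mem_univ _) zero_lt_one h₀).trans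
    (hφ.slope_le_of_hasDerivAt (Set.mem_univ _) (Set.mem_univ _) zero_lt_one h₁)

/-- In the noiseless setting with no outliers, the surrogate loss direction
satisfies a restricted secant inequality at `w*` (Lemma 1 of the paper). -/
theorem mkl_sgd_restricted_secant
    {E : Type*} [NormedAddCommGroup E] [InnerProductSpace ℝ E]
    (n : ℕ) (hn : 1 ≤ n)
    (f : Fin n → E → ℝ) (g : Fin n → E → E)
    (hconv : ∀ i, ConvexOn ℝ Set.univ (f i))
    (hdiff : ∀ i w, HasFDerivAt (f i) ((innerSL ℝ) (g i w)) w)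
    (lam : ℝ) (hlam : 0 < lam)
    (hsc : ∀ w v : E, ⟪(∑ i, g i w) - (∑ i, g i v), w - v⟫ ≥ lam * ‖w - v‖ ^ 2)
    (wstar : E) (hstar : ∀ i, g i wstar = 0) :
    ∀ (w : E) (p : Fin n → ℝ) (pmin : ℝ), 0 < pmin → (∀ i, pmin ≤ p i) →
      ⟪∑ i, p i • g i w, w - wstar⟫ ≥ pmin * lam * ‖w - wstar‖ ^ 2 := by
  intro w p pmin hpmin hp
  have hnonneg (i : Fin n) : 0 ≤ ⟪g i w, w - wstar⟫ := by
    simpa [hstar i] using (hconv i).inner_gradient_sub_nonneg (hdiff i w) (hdiff i wstar)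
  have hsum : lam * ‖w - wstar‖ ^ 2 ≤ ∑ i, ⟪g i w, w - wstar⟫ := by
    simpa [hstar, sum_inner] using hsc w wstar
  calc pmin * lam * ‖w - wstar‖ ^ 2
      ≤ pmin * ∑ i, ⟪g i w, w - wstar⟫ := by
        rw [mul_assoc]
        exact mul_le_mul_of_nonneg_left hsum hpmin.le
    _ ≤ ∑ i, p i * ⟪g i w, w - wstar⟫ := by
        rw [mul_sum]
        exact sum_le_sum fun i _ => mul_le_mul_of_nonneg_right (hp i) (hnonneg i)
    _ = ⟪∑ i, p i • g i w, w - wstar⟫ := by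
        simp [sum_inner, real_inner_smul_left]
end

section
/- Let E be a real inner product space, let n ≥ 1, and let f₁, …, fₙ : E → ℝ be convex differentiable functions with gradients ∇fᵢ such that F(w) = Σᵢ₌₁ⁿ fᵢ(w) is λ-strongly convex (⟨∇F(w) − ∇F(v), w − v⟩ ≥ λ‖w − v‖² for all w, v, λ > 0) and ∇fᵢ(w*) = 0 for every i. Let p : E → (Fin n → ℝ) be any weight assignment satisfying pᵢ(w) ≥ p_min > 0 for all i and all w. Then the expected MKL-SGD update direction ∇F̃(w) := Σᵢ₌₁ⁿ pᵢ(w) ∇fᵢ(w) satisfies ∇F̃(w) = 0 if and only if w = w*. -/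
open RealInnerProductSpace Finset

/-- The derivative of a convex function is a monotone operator. -/
theorem ConvexOn.hasFDerivAt_apply_sub_le {E : Type*} [NormedAddCommGroup E] [NormedSpace ℝ E]
    {f : E → ℝ} (hf : ConvexOn ℝ Set.univ f) {x y : E} {f'x f'y : E →L[ℝ] ℝ}
    (hx : HasFDerivAt f f'x x) (hy : HasFDerivAt f f'y y) :
    f'x (y - x) ≤ f'y (y - x) := by
  have hline : ConvexOn ℝ Set.univ (f ∘ AffineMap.lineMap (k := ℝ) x y) :=
    hf.comp_affineMap (AffineMap.lineMap x y)
  have h0 : HasDerivAt (f ∘ AffineMap.lineMap (k := ℝ) x y) (f'x (y - x)) 0 :=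
    HasFDerivAt.comp_hasDerivAt (0 : ℝ) (by simpa using hx) AffineMap.hasDerivAt_lineMap
  have h1 : HasDerivAt (f ∘ AffineMap.lineMap (k := ℝ) x y) (f'y (y - x)) 1 :=
    HasFDerivAt.comp_hasDerivAt (1 : ℝ) (by simpa using hy) AffineMap.hasDerivAt_lineMap
  exact (hline.le_slope_of_hasDerivAt (Set.mem_univ _) (Set.mem_univ _) one_pos h0).trans
    (hline.slope_le_of_hasDerivAt (Set.mem_univ _) (Set.mem_univ _) one_pos h1)

/-- In the noiseless setting with no outliers, `w*` is the unique (expected)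
fixed point of MKL-SGD (Theorem 1 of the paper). -/
theorem mkl_sgd_unique_stationary_point
    {E : Type*} [NormedAddCommGroup E] [InnerProductSpace ℝ E]
    (n : ℕ) (hn : 1 ≤ n)
    (f : Fin n → E → ℝ) (g : Fin n → E → E)
    (hconv : ∀ i, ConvexOn ℝ Set.univ (f i))
    (hdiff : ∀ i w, HasFDerivAt (f i) ((innerSL ℝ) (g i w)) w)
    (lam : ℝ) (hlam : 0 < lam)
    (hsc : ∀ w v : E, ⟪(∑ i, g i w) - (∑ i, g i v), w - v⟫ ≥ lam * ‖w - v‖ ^ 2)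
    (wstar : E) (hstar : ∀ i, g i wstar = 0)
    (p : E → Fin n → ℝ) (pmin : ℝ) (hpmin : 0 < pmin)
    (hp : ∀ w i, pmin ≤ p w i) :
    ∀ w : E, (∑ i, p w i • g i w) = 0 ↔ w = wstar := by
  intro w
  refine ⟨fun h => ?_, fun h => by simp [h, hstar]⟩
  have hnonneg : ∀ i, 0 ≤ ⟪g i w, w - wstar⟫ := fun i => by
    simpa [hstar i] using (hconv i).hasFDerivAt_apply_sub_le (hdiff i wstar) (hdiff i w)
  have hsum : lam * ‖w - wstar‖ ^ 2 ≤ ∑ i, ⟪g i w, w - wstar⟫ := by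
    simpa [hstar, sum_inner] using hsc w wstar
  have hweighted : pmin * ∑ i, ⟪g i w, w - wstar⟫ ≤ 0 := by
    calc pmin * ∑ i, ⟪g i w, w - wstar⟫
        ≤ ∑ i, p w i * ⟪g i w, w - wstar⟫ := by
          rw [mul_sum]
          exact sum_le_sum fun i _ => mul_le_mul_of_nonneg_right (hp w i) (hnonneg i)
      _ = ⟪∑ i, p w i • g i w, w - wstar⟫ := by simp [sum_inner, real_inner_smul_left]
      _ = 0 := by rw [h, inner_zero_left]
  have hsq : ‖w - wstar‖ ^ 2 ≤ 0 :=
    nonpos_of_mul_nonpos_right (hsum.trans (nonpos_of_mul_nonpos_right hweighted hpmin)) hlam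
  simpa [sub_eq_zero] using le_antisymm hsq (sq_nonneg _)
end

section
/- Let the index set {1, …, n} be partitioned into a nonempty set G of clean samples and a nonempty set O of outliers. Let l₁, …, lₙ > 0 with l_min = minᵢ lᵢ, l_max = maxᵢ lᵢ, κ = l_max/l_min, l_m = min_{i∈G} lᵢ, l_M = max_{j∈O} lⱼ. Let p₁, …, pₙ ≥ 0 with Σᵢ pᵢ = 1 and set p̂ = Σ_{j∈O} pⱼ. Let w*, w_B ∈ ℝ, let w̄ := (Σ_{i∈G} pᵢ lᵢ w* + Σ_{j∈O} pⱼ lⱼ w_B)/(Σᵢ pᵢ lᵢ) be the stationary point of the weighted loss, and let w̃ := (√l_m · w* + √l_M · w_B)/(√l_m + √l_M). If p̂ ≤ 1/(1 + κ√κ), then |w̄ − w*| ≤ |w̃ − w*| = (√l_M/(√l_m + √l_M))·|w_B − w*|. -/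
open Finset

/-- The distance from `x` to the weighted mean of `x` and `y` is the relative weight of `y`
times the distance between the two points. -/
lemma abs_weighted_mean_sub {a b : ℝ} (hb : 0 ≤ b) (hab : 0 < a + b) (x y : ℝ) :
    |(a * x + b * y) / (a + b) - x| = b / (a + b) * |y - x| := by
  have h : (a * x + b * y) / (a + b) - x = b / (a + b) * (y - x) := by
    field_simp
    ring
  rw [h, abs_mul, abs_of_nonneg (div_nonneg hb hab.le)]

/-- If `M ≤ κ m`, then total weight `B` made of mass `q ≤ 1 / (1 + κ √κ)` with weights at most `M`
and total weight `A` made of mass `1 - q` with weights at least `m` satisfy `B / A ≤ √M / √m`. -/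
lemma mul_sqrt_le_mul_sqrt_of_mass_le {m M κ q A B : ℝ} (hm : 0 < m) (hM : 0 < M)
    (hκ : 1 ≤ κ) (hMm : M ≤ κ * m) (hq : 0 ≤ q) (hqκ : q ≤ 1 / (1 + κ * √κ))
    (hA : m * (1 - q) ≤ A) (hB : B ≤ M * q) :
    B * √m ≤ A * √M := by
  have hκ0 : 0 ≤ κ := by linarith
  have hk : 0 ≤ κ * √κ := by positivity
  have hqk : q * (κ * √κ) ≤ 1 - q := by
    rw [le_div_iff₀ (by linarith)] at hqκ
    linarith
  have hsqrt : √M ≤ κ * √κ * √m := by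
    calc √M ≤ √(κ * m) := Real.sqrt_le_sqrt hMm
      _ = 1 * (√κ * √m) := by rw [Real.sqrt_mul hκ0, one_mul]
      _ ≤ κ * (√κ * √m) := by gcongr
      _ = κ * √κ * √m := by ring
  have hbal : √M * q ≤ √m * (1 - q) := by
    calc √M * q ≤ κ * √κ * √m * q := by gcongr
      _ = √m * (q * (κ * √κ)) := by ring
      _ ≤ √m * (1 - q) := by gcongr
  calc B * √m ≤ M * q * √m := by gcongr
    _ = √M * √m * (√M * q) := by
      linear_combination (-(q * √m)) * Real.mul_self_sqrt hM.le
    _ ≤ √M * √m * (√m * (1 - q)) := by gcongr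
    _ = m * (1 - q) * √M := by
      linear_combination ((1 - q) * √M) * Real.mul_self_sqrt hm.le
    _ ≤ A * √M := by gcongr

/-- Scalar squared-loss setting with outliers (Condition 1 of the paper): if
the total probability mass `p̂` on the outliers satisfies
`p̂ ≤ 1/(1 + κ√κ)`, then the stationary point `w̄` of the weighted loss is no
farther from `w*` than the intersection point `w̃`, whose distance from `w*`
is `(√l_M/(√l_m + √l_M))·|w_B − w*|`. -/
theorem mkl_sgd_scalar_condition
    (n : ℕ) (G O : Finset (Fin n))
    (hG : G.Nonempty) (hO : O.Nonempty)
    (hdisj : Disjoint G O) (hcover : G ∪ O = Finset.univ)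
    (l : Fin n → ℝ) (hl : ∀ i, 0 < l i)
    (lmin lmax lm lM κ : ℝ)
    (hlmin : IsLeast (Set.range l) lmin)
    (hlmax : IsGreatest (Set.range l) lmax)
    (hlm : IsLeast (l '' ↑G) lm)
    (hlM : IsGreatest (l '' ↑O) lM)
    (hκ : κ = lmax / lmin)
    (p : Fin n → ℝ) (hp : ∀ i, 0 ≤ p i) (hpsum : ∑ i, p i = 1)
    (phat : ℝ) (hphat : phat = ∑ j ∈ O, p j)
    (wstar wB : ℝ)
    (wbar : ℝ)
    (hwbar : wbar = ((∑ i ∈ G, p i * l i * wstar) + (∑ j ∈ O, p j * l j * wB))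
        / (∑ i, p i * l i))
    (wt : ℝ)
    (hwt : wt = (Real.sqrt lm * wstar + Real.sqrt lM * wB)
        / (Real.sqrt lm + Real.sqrt lM))
    (hcond : phat ≤ 1 / (1 + κ * Real.sqrt κ)) :
    |wbar - wstar| ≤ |wt - wstar| ∧
      |wt - wstar| = (Real.sqrt lM / (Real.sqrt lm + Real.sqrt lM)) * |wB - wstar| := by
  have hlmin0 : 0 < lmin := by
    obtain ⟨i, rfl⟩ := hlmin.1
    exact hl i
  have hlm0 : 0 < lm := by
    obtain ⟨i, -, rfl⟩ := hlm.1
    exact hl i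
  have hlM0 : 0 < lM := by
    obtain ⟨i, -, rfl⟩ := hlM.1
    exact hl i
  have hminm : lmin ≤ lm := hlmin.2 (Set.image_subset_range _ _ hlm.1)
  have hMmax : lM ≤ lmax := hlmax.2 (Set.image_subset_range _ _ hlM.1)
  have hκ1 : 1 ≤ κ := by
    rw [hκ, one_le_div hlmin0]
    exact hlmax.2 hlmin.1
  have hMm : lM ≤ κ * lm := by
    calc lM ≤ lmax := hMmax
      _ = κ * lmin := by rw [hκ, div_mul_cancel₀ _ hlmin0.ne']
      _ ≤ κ * lm := by gcongr
  have hsplit (f : Fin n → ℝ) : ∑ i, f i = ∑ i ∈ G, f i + ∑ i ∈ O, f i := by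
    rw [← hcover, sum_union hdisj]
  have hmass : ∑ i ∈ G, p i = 1 - phat := by
    have := hsplit p
    linarith
  have hA : lm * (1 - phat) ≤ ∑ i ∈ G, p i * l i := by
    rw [← hmass, mul_sum]
    refine sum_le_sum fun i hi => ?_
    rw [mul_comm]
    exact mul_le_mul_of_nonneg_left (hlm.2 ⟨i, hi, rfl⟩) (hp i)
  have hB : ∑ j ∈ O, p j * l j ≤ lM * phat := by
    rw [hphat, mul_sum]
    refine sum_le_sum fun i hi => ?_
    rw [mul_comm lM]
    exact mul_le_mul_of_nonneg_left (hlM.2 ⟨i, hi, rfl⟩) (hp i)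
  have hB0 : 0 ≤ ∑ j ∈ O, p j * l j := sum_nonneg fun i _ => mul_nonneg (hp i) (hl i).le
  have hphat0 : 0 ≤ phat := hphat ▸ sum_nonneg fun i _ => hp i
  have hAB : 0 < ∑ i ∈ G, p i * l i + ∑ j ∈ O, p j * l j := by
    rw [← hsplit]
    calc 0 < lmin := hlmin0
      _ = ∑ i, p i * lmin := by rw [← sum_mul, hpsum, one_mul]
      _ ≤ ∑ i, p i * l i :=
        sum_le_sum fun i _ => mul_le_mul_of_nonneg_left (hlmin.2 ⟨i, rfl⟩) (hp i)
  have hs : 0 < √lm + √lM := by positivity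
  have hwt' : |wt - wstar| = √lM / (√lm + √lM) * |wB - wstar| := by
    rw [hwt, abs_weighted_mean_sub (Real.sqrt_nonneg _) hs]
  refine ⟨?_, hwt'⟩
  rw [hwt', hwbar, hsplit, ← sum_mul, ← sum_mul, abs_weighted_mean_sub hB0 hAB]
  refine mul_le_mul_of_nonneg_right ?_ (abs_nonneg _)
  rw [div_le_div_iff₀ hAB hs]
  linarith [mul_sqrt_le_mul_sqrt_of_mass_le hlm0 hlM0 hκ1 hMm hphat0 hcond hA hB]
end

section
/- Let E be a real inner product space and let the index set {1, …, n} be partitioned into a nonempty set G of clean samples and a nonempty set O of outliers. Let l₁, …, lₙ > 0 with κ = (maxᵢ lᵢ)/(minᵢ lᵢ), l_m = min_{i∈G} lᵢ, l_M = max_{j∈O} lⱼ. Each clean sample is centered at w* ∈ E and each outlier j ∈ O is centered at w_{bⱼ} ∈ E with δⱼ := ‖w_{bⱼ} − w*‖ > 0; set δ_min = minⱼ δⱼ, δ_max = maxⱼ δⱼ, γ = δ_min/δ_max. Let c ∈ (0, 1] and Γ := γ/c. Let p₁, …, pₙ ≥ 0 with Σᵢ pᵢ = 1 and p̂ := Σ_{j∈O}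 pⱼ, and let w̄ := (Σ_{i∈G} pᵢ lᵢ w* + Σ_{j∈O} pⱼ lⱼ w_{bⱼ})/(Σᵢ pᵢ lᵢ) be the stationary point of the weighted quadratic loss. If q := 1/Γ − 1 + √κ/Γ > 0 and p̂ ≤ 1/(1 + κq), then ‖w̄ − w*‖ ≤ (√l_M/(√l_m + √l_M)) · δ_min/c. -/
open Finset

/-- The distance from a point to a weighted mean of that point and further centers is at most
the share of the weight on the further centers times their largest distance. -/
theorem norm_weighted_mean_sub_le {ι E : Type*} [NormedAddCommGroup E] [NormedSpace ℝ E]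
    (G O : Finset ι) (a : ι → ℝ) (ha : ∀ i, 0 ≤ a i)
    (hT : 0 < ∑ i ∈ G, a i + ∑ j ∈ O, a j) (x : E) (y : ι → E) (D : ℝ)
    (hD : ∀ j ∈ O, ‖y j - x‖ ≤ D) :
    ‖(∑ i ∈ G, a i + ∑ j ∈ O, a j)⁻¹ • ((∑ i ∈ G, a i • x) + ∑ j ∈ O, a j • y j) - x‖ ≤
      (∑ j ∈ O, a j) * D / (∑ i ∈ G, a i + ∑ j ∈ O, a j) := by
  have hmean : (∑ i ∈ G, a i + ∑ j ∈ O, a j)⁻¹ • ((∑ i ∈ G, a i • x) + ∑ j ∈ O, a j • y j) - x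
      = (∑ i ∈ G, a i + ∑ j ∈ O, a j)⁻¹ • ∑ j ∈ O, a j • (y j - x) := by
    have hx : x = (∑ i ∈ G, a i + ∑ j ∈ O, a j)⁻¹ • (∑ i ∈ G, a i + ∑ j ∈ O, a j) • x :=
      (inv_smul_smul₀ hT.ne' x).symm
    nth_rewrite 2 [hx]
    rw [← smul_sub]
    congr 1
    simp only [smul_sub, Finset.sum_sub_distrib, ← Finset.sum_smul, add_smul]
    abel
  rw [hmean, norm_smul, norm_inv, Real.norm_of_nonneg hT.le, inv_mul_eq_div, Finset.sum_mul]
  gcongr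
  refine norm_sum_le_of_le _ fun j hj => ?_
  rw [norm_smul, Real.norm_of_nonneg (ha j)]
  exact mul_le_mul_of_nonneg_left (hD j hj) (ha j)

/-- Vector squared-loss setting with outliers (Lemma 2 of the paper): if
`q = 1/Γ − 1 + √κ/Γ > 0` and the total outlier probability mass satisfies
`p̂ ≤ 1/(1 + κq)`, then the stationary point `w̄` of the weighted quadratic
loss satisfies `‖w̄ − w*‖ ≤ (√l_M/(√l_m + √l_M))·δ_min/c`. -/
theorem mkl_sgd_vector_condition
    {E : Type*} [NormedAddCommGroup E] [InnerProductSpace ℝ E]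
    (n : ℕ) (G O : Finset (Fin n))
    (hG : G.Nonempty) (hO : O.Nonempty)
    (hdisj : Disjoint G O) (hcover : G ∪ O = Finset.univ)
    (l : Fin n → ℝ) (hl : ∀ i, 0 < l i)
    (lmin lmax lm lM κ : ℝ)
    (hlmin : IsLeast (Set.range l) lmin)
    (hlmax : IsGreatest (Set.range l) lmax)
    (hlm : IsLeast (l '' ↑G) lm)
    (hlM : IsGreatest (l '' ↑O) lM)
    (hκ : κ = lmax / lmin)
    (wstar : E) (wb : Fin n → E)
    (hδpos : ∀ j ∈ O, 0 < ‖wb j - wstar‖)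
    (δmin δmax γ : ℝ)
    (hδmin : IsLeast ((fun j => ‖wb j - wstar‖) '' ↑O) δmin)
    (hδmax : IsGreatest ((fun j => ‖wb j - wstar‖) '' ↑O) δmax)
    (hγ : γ = δmin / δmax)
    (c : ℝ) (hc : c ∈ Set.Ioc (0 : ℝ) 1)
    (Γ : ℝ) (hΓ : Γ = γ / c)
    (p : Fin n → ℝ) (hp : ∀ i, 0 ≤ p i) (hpsum : ∑ i, p i = 1)
    (phat : ℝ) (hphat : phat = ∑ j ∈ O, p j)
    (wbar : E)
    (hwbar : wbar = (∑ i, p i * l i)⁻¹ •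
        ((∑ i ∈ G, (p i * l i) • wstar) + (∑ j ∈ O, (p j * l j) • wb j)))
    (q : ℝ) (hq : q = 1 / Γ - 1 + Real.sqrt κ / Γ)
    (hqpos : 0 < q)
    (hcond : phat ≤ 1 / (1 + κ * q)) :
    ‖wbar - wstar‖ ≤ (Real.sqrt lM / (Real.sqrt lm + Real.sqrt lM)) * δmin / c := by
  obtain ⟨hc0, -⟩ := hc
  have hlmin0 : 0 < lmin := by obtain ⟨i, rfl⟩ := hlmin.1; exact hl i
  have hlm0 : 0 < lm := by obtain ⟨i, -, rfl⟩ := hlm.1; exact hl i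
  have hlM0 : 0 < lM := by obtain ⟨i, -, rfl⟩ := hlM.1; exact hl i
  have hδmin0 : 0 < δmin := by obtain ⟨j, hj, rfl⟩ := hδmin.1; exact hδpos j hj
  have hδmax0 : 0 < δmax := by obtain ⟨j, hj, rfl⟩ := hδmax.1; exact hδpos j hj
  have hminlm : lmin ≤ lm := by obtain ⟨i, -, rfl⟩ := hlm.1; exact hlmin.2 ⟨i, rfl⟩
  have hminlM : lmin ≤ lM := by obtain ⟨i, -, rfl⟩ := hlM.1; exact hlmin.2 ⟨i, rfl⟩
  have hlmmax : lm ≤ lmax := by obtain ⟨i, -, rfl⟩ := hlm.1; exact hlmax.2 ⟨i, rfl⟩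
  have hlMmax : lM ≤ lmax := by obtain ⟨i, -, rfl⟩ := hlM.1; exact hlmax.2 ⟨i, rfl⟩
  have hκ0 : 0 < κ := by rw [hκ]; exact div_pos (hlm0.trans_le hlmmax) hlmin0
  have hκmin : κ * lmin = lmax := by rw [hκ, div_mul_cancel₀ _ hlmin0.ne']
  have hlMκ : lM ≤ κ * lm := by nlinarith
  have hlmκ : lm ≤ κ * lM := by nlinarith
  have hsqrt : √lm ≤ √κ * √lM := by
    rw [← Real.sqrt_mul hκ0.le]; exact Real.sqrt_le_sqrt hlmκ
  have hsum (f : Fin n → ℝ) : ∑ i, f i = ∑ i ∈ G, f i + ∑ j ∈ O, f j := by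
    rw [← hcover, Finset.sum_union hdisj]
  have hphat0 : 0 ≤ phat := by rw [hphat]; exact Finset.sum_nonneg fun j _ => hp j
  have hclean : ∑ i ∈ G, p i = 1 - phat := by
    have := hsum p
    linarith
  have hmass : κ * q * phat ≤ 1 - phat := by
    rw [le_div_iff₀ (by positivity)] at hcond
    linarith
  have hA : ∑ j ∈ O, p j * l j ≤ phat * lM := by
    rw [hphat, Finset.sum_mul]
    exact Finset.sum_le_sum fun j hj => mul_le_mul_of_nonneg_left (hlM.2 ⟨j, hj, rfl⟩) (hp j)
  have hB : (1 - phat) * lm ≤ ∑ i ∈ G, p i * l i := by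
    rw [← hclean, Finset.sum_mul]
    exact Finset.sum_le_sum fun i hi => mul_le_mul_of_nonneg_left (hlm.2 ⟨i, hi, rfl⟩) (hp i)
  have hratio : (∑ j ∈ O, p j * l j) * q ≤ ∑ i ∈ G, p i * l i := by
    calc (∑ j ∈ O, p j * l j) * q ≤ phat * lM * q := by gcongr
      _ ≤ phat * (κ * lm) * q := by gcongr
      _ = κ * q * phat * lm := by ring
      _ ≤ (1 - phat) * lm := by gcongr
      _ ≤ _ := hB
  have hT : 0 < ∑ i ∈ G, p i * l i + ∑ j ∈ O, p j * l j := by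
    rw [← hsum fun i => p i * l i]
    calc 0 < lmin := hlmin0
      _ = ∑ i, p i * lmin := by rw [← Finset.sum_mul, hpsum, one_mul]
      _ ≤ _ := Finset.sum_le_sum fun i _ => mul_le_mul_of_nonneg_left (hlmin.2 ⟨i, rfl⟩) (hp i)
  have hq1 : δmax / (1 + q) = δmin / c / (1 + √κ) := by
    have h1q : 1 + q = (1 + √κ) * (δmax * c / δmin) := by
      rw [hq, hΓ, hγ]
      field_simp
      ring
    rw [h1q]
    have := Real.sqrt_nonneg κ
    field_simp
  have hsM : 0 < √lM := Real.sqrt_pos.2 hlM0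
  rw [hwbar, hsum fun i => p i * l i]
  calc _ ≤ (∑ j ∈ O, p j * l j) * δmax / (∑ i ∈ G, p i * l i + ∑ j ∈ O, p j * l j) :=
        norm_weighted_mean_sub_le G O (fun i => p i * l i)
          (fun i => mul_nonneg (hp i) (hl i).le) hT wstar wb δmax fun j hj => hδmax.2 ⟨j, hj, rfl⟩
    _ ≤ δmax / (1 + q) := by
        rw [div_le_div_iff₀ hT (by positivity)]
        nlinarith
    _ = δmin / c / (1 + √κ) := hq1
    _ ≤ δmin / c * (√lM / (√lm + √lM)) := by
        rw [div_eq_mul_one_div _ (1 + √κ)]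
        refine mul_le_mul_of_nonneg_left ?_ (by positivity)
        rw [div_le_div_iff₀ (by positivity) (by positivity)]
        linarith
    _ = _ := by ring
end

section
/- Let E be a real inner product space and let f₁, …, fₙ : E → ℝ be differentiable. Let the index set be partitioned into clean samples G and outliers O. Let p₁, …, pₙ ≥ 0 with Σᵢ pᵢ = 1, set ε̂ := Σ_{j∈O} pⱼ, and let w̄ satisfy Σᵢ pᵢ ∇fᵢ(w̄) = 0. Suppose for each i ∈ G, ∇fᵢ(w*) = 0 and ‖∇fᵢ(w) − ∇fᵢ(w*)‖ ≤ L‖w − w*‖ for all w, and ‖∇fⱼ(w̄)‖ ≤ G_b for each j ∈ O. Then ‖Σ_{i∈G} pᵢ ∇fᵢ(w̄)‖ ≤ min( (1 − ε̂) L ‖w̄ − w*‖, ε̂ G_b ). -/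
open Finset

/-- A sum with nonnegative weights of vectors of norm at most `C` has norm at most the total
weight times `C`. -/
theorem norm_sum_smul_le_of_norm_le {ι E : Type*} [SeminormedAddCommGroup E] [NormedSpace ℝ E]
    {s : Finset ι} {p : ι → ℝ} {v : ι → E} {C : ℝ} (hp : ∀ i, 0 ≤ p i)
    (hv : ∀ i ∈ s, ‖v i‖ ≤ C) : ‖∑ i ∈ s, p i • v i‖ ≤ (∑ i ∈ s, p i) * C := by
  rw [sum_mul]
  refine norm_sum_le_of_le s fun i hi => ?_
  rw [norm_smul, Real.norm_of_nonneg (hp i)]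
  exact mul_le_mul_of_nonneg_left (hv i hi) (hp i)

/-- Bound on the weighted clean gradient sum at an MKL-SGD stationary point
(Lemma 6 of the paper). -/
theorem mkl_stationary_weighted_gradient_bound
    {E : Type*} [NormedAddCommGroup E] [InnerProductSpace ℝ E]
    (n : ℕ) (f : Fin n → E → ℝ) (g : Fin n → E → E)
    (hdiff : ∀ i w, HasFDerivAt (f i) ((innerSL ℝ) (g i w)) w)
    (G O : Finset (Fin n))
    (hdisj : Disjoint G O) (hcover : G ∪ O = Finset.univ)
    (p : Fin n → ℝ) (hp : ∀ i, 0 ≤ p i) (hpsum : ∑ i, p i = 1)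
    (εhat : ℝ) (hεhat : εhat = ∑ j ∈ O, p j)
    (wbar wstar : E) (hstat : (∑ i, p i • g i wbar) = 0)
    (L : ℝ)
    (hclean : ∀ i ∈ G, g i wstar = 0)
    (hLip : ∀ i ∈ G, ∀ w : E, ‖g i w - g i wstar‖ ≤ L * ‖w - wstar‖)
    (Gb : ℝ) (hGb : ∀ j ∈ O, ‖g j wbar‖ ≤ Gb) :
    ‖∑ i ∈ G, p i • g i wbar‖ ≤ min ((1 - εhat) * L * ‖wbar - wstar‖) (εhat * Gb) := by
  rw [← hcover, sum_union hdisj] at hpsum hstat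
  refine le_min ?_ ?_
  · have hclean_mass : 1 - εhat = ∑ i ∈ G, p i := by linarith
    rw [hclean_mass, mul_assoc]
    refine norm_sum_smul_le_of_norm_le hp fun i hi => ?_
    simpa [hclean i hi] using hLip i hi wbar
  · rw [eq_neg_of_add_eq_zero_left hstat, norm_neg, hεhat]
    exact norm_sum_smul_le_of_norm_le hp hGb
end

section
/- Let E be a real inner product space and let f₁, …, fₙ : E → ℝ be convex differentiable functions such that each ∇fᵢ is Lᵢ-Lipschitz; set L := maxᵢ Lᵢ. Let the index set be partitioned into clean samples G and outliers O, and suppose the clean sum is strongly convex: ⟨Σ_{i∈G}(∇fᵢ(w) − ∇fᵢ(v)), w − v⟩ ≥ λ_g ‖w − v‖² for all w, v, with λ_g > 0. Let p₁, …, pₙ ≥ 0 with Σᵢ pᵢ = 1, let w_t, w* ∈ E, let Δ_t = w_t − w*, and let 0 < η ≤ 1/L. Then Σᵢ₌₁ⁿ pᵢ ‖w_t − η∇fᵢ(w_t) − w*‖² ≤ (1 − 2η λ_g (1 − ηL) · min_{i∈G} pᵢ) ‖Δ_t‖² + R_t, where R_t = −2η Σ_{i∈G} pᵢ ⟨Δ_t,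 ∇fᵢ(w*)⟩ + 2η² Σ_{i∈G} pᵢ ‖∇fᵢ(w*)‖² + η² Σ_{j∈O} pⱼ ‖∇fⱼ(w_t)‖² + 2η Σ_{j∈O} pⱼ (fⱼ(w*) − fⱼ(w_t)). -/
open RealInnerProductSpace Finset

section ConvexSmooth

variable {E : Type*} [NormedAddCommGroup E] [InnerProductSpace ℝ E] {f : E → ℝ} {g : E → E}

theorem hasDerivAt_comp_add_smul (hdiff : ∀ w, HasFDerivAt f ((innerSL ℝ) (g w)) w)
    (x v : E) (t : ℝ) :
    HasDerivAt (fun s : ℝ => f (x + s • v)) ⟪g (x + t • v), v⟫ t := by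
  have hline : HasDerivAt (fun s : ℝ => x + s • v) v t := by
    simpa using ((hasDerivAt_id t).smul_const v).const_add x
  exact (hdiff (x + t • v)).comp_hasDerivAt t hline

/-- A differentiable convex function lies above its tangent planes. -/
theorem ConvexOn.add_inner_le (hconv : ConvexOn ℝ Set.univ f)
    (hdiff : ∀ w, HasFDerivAt f ((innerSL ℝ) (g w)) w) (x y : E) :
    f x + ⟪g x, y - x⟫ ≤ f y := by
  have hline : ConvexOn ℝ Set.univ (fun s : ℝ => f (x + s • (y - x))) := by
    have h := hconv.comp_affineMap (AffineMap.lineMap x y : ℝ →ᵃ[ℝ] E)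
    rw [Set.preimage_univ] at h
    have hcomp : f ∘ (AffineMap.lineMap x y : ℝ →ᵃ[ℝ] E) = fun s : ℝ => f (x + s • (y - x)) := by
      ext s
      simp [AffineMap.lineMap_apply, add_comm]
    rwa [hcomp] at h
  have h := hline.le_slope_of_hasDerivAt (Set.mem_univ 0) (Set.mem_univ 1) one_pos
    (hasDerivAt_comp_add_smul hdiff x (y - x) 0)
  simp [slope_def_field] at h
  linarith

/-- The descent lemma: a function with `L`-Lipschitz gradient is bounded above by its tangent
plane plus a quadratic term. -/
theorem le_add_inner_add_sq_of_lipschitz_gradient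
    (hdiff : ∀ w, HasFDerivAt f ((innerSL ℝ) (g w)) w) {L : ℝ}
    (hLip : ∀ w v, ‖g w - g v‖ ≤ L * ‖w - v‖) (x v : E) :
    f (x + v) ≤ f x + ⟪g x, v⟫ + L / 2 * ‖v‖ ^ 2 := by
  have hderiv (t : ℝ) : HasDerivAt
      (fun s : ℝ => f (x + s • v) - s * ⟪g x, v⟫ - s ^ 2 * (L / 2 * ‖v‖ ^ 2))
      (⟪g (x + t • v), v⟫ - ⟪g x, v⟫ - 2 * t * (L / 2 * ‖v‖ ^ 2)) t := by
    refine HasDerivAt.congr_deriv (((hasDerivAt_comp_add_smul hdiff x v t).sub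
      ((hasDerivAt_id t).mul_const ⟪g x, v⟫)).sub
      ((hasDerivAt_pow 2 t).mul_const (L / 2 * ‖v‖ ^ 2))) ?_
    simp
  have hanti := antitoneOn_of_deriv_nonpos (convex_Ici (0 : ℝ))
    (fun t _ => (hderiv t).continuousAt.continuousWithinAt)
    (fun t _ => (hderiv t).differentiableAt.differentiableWithinAt)
    (fun t ht => by
      rw [interior_Ici, Set.mem_Ioi] at ht
      rw [(hderiv t).deriv, ← inner_sub_left]
      have hnorm : ‖g (x + t • v) - g x‖ ≤ L * (t * ‖v‖) := by
        simpa [norm_smul, abs_of_pos ht] using hLip (x + t • v) x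
      have := real_inner_le_norm (g (x + t • v) - g x) v
      have := mul_le_mul_of_nonneg_right hnorm (norm_nonneg v)
      nlinarith)
  have h := hanti (Set.mem_Ici.2 le_rfl) (Set.mem_Ici.2 zero_le_one) zero_le_one
  simp at h
  linarith

theorem ConvexOn.add_inner_add_sq_le_of_lipschitz_gradient (hconv : ConvexOn ℝ Set.univ f)
    (hdiff : ∀ w, HasFDerivAt f ((innerSL ℝ) (g w)) w) {L : ℝ} (hL : 0 < L)
    (hLip : ∀ w v, ‖g w - g v‖ ≤ L * ‖w - v‖) (x y : E) :
    f y + ⟪g y, x - y⟫ + 1 / (2 * L) * ‖g x - g y‖ ^ 2 ≤ f x := by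
  have hlower := hconv.add_inner_le hdiff y (x + (-L⁻¹) • (g x - g y))
  have hupper := le_add_inner_add_sq_of_lipschitz_gradient hdiff hLip x ((-L⁻¹) • (g x - g y))
  rw [add_sub_right_comm, inner_add_right, inner_smul_right] at hlower
  rw [inner_smul_right, norm_smul, mul_pow, Real.norm_eq_abs, sq_abs] at hupper
  have hd : ⟪g x, g x - g y⟫ - ⟪g y, g x - g y⟫ = ‖g x - g y‖ ^ 2 := by
    rw [← inner_sub_left, real_inner_self_eq_norm_sq]
  have hcoef : L / 2 * ((-L⁻¹) ^ 2 * ‖g x - g y‖ ^ 2) =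
      L⁻¹ * ‖g x - g y‖ ^ 2 - 1 / (2 * L) * ‖g x - g y‖ ^ 2 := by
    field_simp
    ring
  rw [hcoef, ← hd] at hupper
  rw [← hd]
  linarith

/-- Baillon–Haddad: an `L`-Lipschitz gradient of a convex function is `1 / L`-cocoercive. -/
theorem ConvexOn.sq_norm_sub_le_mul_inner_of_lipschitz_gradient (hconv : ConvexOn ℝ Set.univ f)
    (hdiff : ∀ w, HasFDerivAt f ((innerSL ℝ) (g w)) w) {L : ℝ} (hL : 0 < L)
    (hLip : ∀ w v, ‖g w - g v‖ ≤ L * ‖w - v‖) (x y : E) :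
    ‖g x - g y‖ ^ 2 ≤ L * ⟪g x - g y, x - y⟫ := by
  have hxy := hconv.add_inner_add_sq_le_of_lipschitz_gradient hdiff hL hLip x y
  have hyx := hconv.add_inner_add_sq_le_of_lipschitz_gradient hdiff hL hLip y x
  rw [norm_sub_rev, ← neg_sub x y, inner_neg_right] at hyx
  have hhalf : 1 / (2 * L) * ‖g x - g y‖ ^ 2 + 1 / (2 * L) * ‖g x - g y‖ ^ 2 =
      ‖g x - g y‖ ^ 2 / L := by
    field_simp
    ring
  rw [inner_sub_left, ← div_le_iff₀' hL]
  linarith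

theorem norm_sub_smul_sub_sq (w a z : E) (η : ℝ) :
    ‖w - η • a - z‖ ^ 2 = ‖w - z‖ ^ 2 - 2 * η * ⟪a, w - z⟫ + η ^ 2 * ‖a‖ ^ 2 := by
  rw [sub_right_comm, norm_sub_sq_real, inner_smul_right, norm_smul, mul_pow, Real.norm_eq_abs,
    sq_abs, real_inner_comm]
  ring

/-- Gradient step on a convex function, measured against an arbitrary reference point. -/
theorem ConvexOn.norm_gradient_step_sq_le (hconv : ConvexOn ℝ Set.univ f)
    (hdiff : ∀ w, HasFDerivAt f ((innerSL ℝ) (g w)) w) {η : ℝ} (hη : 0 ≤ η) (w z : E) :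
    ‖w - η • g w - z‖ ^ 2 ≤ ‖w - z‖ ^ 2 + η ^ 2 * ‖g w‖ ^ 2 + 2 * η * (f z - f w) := by
  have h := hconv.add_inner_le hdiff w z
  rw [← neg_sub w z, inner_neg_right] at h
  rw [norm_sub_smul_sub_sq]
  nlinarith

/-- Gradient step on a smooth convex function, measured against an arbitrary reference point. -/
theorem ConvexOn.norm_gradient_step_sq_le_of_lipschitz_gradient (hconv : ConvexOn ℝ Set.univ f)
    (hdiff : ∀ w, HasFDerivAt f ((innerSL ℝ) (g w)) w) {L : ℝ} (hL : 0 < L)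
    (hLip : ∀ w v, ‖g w - g v‖ ≤ L * ‖w - v‖) (η : ℝ) (w z : E) :
    ‖w - η • g w - z‖ ^ 2 ≤ ‖w - z‖ ^ 2 - 2 * η * (1 - η * L) * ⟪g w - g z, w - z⟫
      - 2 * η * ⟪w - z, g z⟫ + 2 * η ^ 2 * ‖g z‖ ^ 2 := by
  have hco := hconv.sq_norm_sub_le_mul_inner_of_lipschitz_gradient hdiff hL hLip w z
  have hpar := parallelogram_law_with_norm ℝ (g w - g z) (g z)
  rw [sub_add_cancel] at hpar
  have hsq : ‖g w‖ ^ 2 ≤ 2 * (L * ⟪g w - g z, w - z⟫) + 2 * ‖g z‖ ^ 2 := by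
    nlinarith [mul_self_nonneg ‖g w - g z - g z‖]
  have hmul := mul_le_mul_of_nonneg_left hsq (sq_nonneg η)
  rw [norm_sub_smul_sub_sq, real_inner_comm (g z) (w - z)]
  rw [inner_sub_left] at hmul ⊢
  linarith

end ConvexSmooth

/-- One-step expected-distance bound for a weighted stochastic gradient
update in the presence of outliers (Theorem 3 of the paper). -/
theorem one_step_distance_bound
    {E : Type*} [NormedAddCommGroup E] [InnerProductSpace ℝ E]
    (n : ℕ) (f : Fin n → E → ℝ) (g : Fin n → E → E)
    (hconv : ∀ i, ConvexOn ℝ Set.univ (f i))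
    (hdiff : ∀ i w, HasFDerivAt (f i) ((innerSL ℝ) (g i w)) w)
    (Li : Fin n → ℝ)
    (hLip : ∀ i, ∀ w v : E, ‖g i w - g i v‖ ≤ Li i * ‖w - v‖)
    (L : ℝ) (hL : IsGreatest (Set.range Li) L)
    (G O : Finset (Fin n)) (hG : G.Nonempty)
    (hdisj : Disjoint G O) (hcover : G ∪ O = Finset.univ)
    (lamg : ℝ) (hlamg : 0 < lamg)
    (hsc : ∀ w v : E, ⟪∑ i ∈ G, (g i w - g i v), w - v⟫ ≥ lamg * ‖w - v‖ ^ 2)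
    (p : Fin n → ℝ) (hp : ∀ i, 0 ≤ p i) (hpsum : ∑ i, p i = 1)
    (pmin : ℝ) (hpmin : IsLeast (p '' ↑G) pmin)
    (wt wstar : E) (η : ℝ) (hη0 : 0 < η) (hηL : η ≤ 1 / L) :
    (∑ i, p i * ‖wt - η • g i wt - wstar‖ ^ 2) ≤
      (1 - 2 * η * lamg * (1 - η * L) * pmin) * ‖wt - wstar‖ ^ 2 +
      (- 2 * η * ∑ i ∈ G, p i * ⟪wt - wstar, g i wstar⟫
       + 2 * η ^ 2 * ∑ i ∈ G, p i * ‖g i wstar‖ ^ 2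
       + η ^ 2 * ∑ j ∈ O, p j * ‖g j wt‖ ^ 2
       + 2 * η * ∑ j ∈ O, p j * (f j wstar - f j wt)) := by
  have hLpos : 0 < L := one_div_pos.mp (hη0.trans_le hηL)
  have hstep : 0 ≤ 1 - η * L := by
    rw [le_div_iff₀ hLpos] at hηL
    linarith
  have hLipL (i : Fin n) (w v : E) : ‖g i w - g i v‖ ≤ L * ‖w - v‖ :=
    (hLip i w v).trans
      (mul_le_mul_of_nonneg_right (hL.2 (Set.mem_range_self i)) (norm_nonneg _))
  have hsplit (F : Fin n → ℝ) : ∑ i, F i = ∑ i ∈ G, F i + ∑ j ∈ O, F j := by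
    rw [← hcover, sum_union hdisj]
  have hgood : ∑ i ∈ G, p i * ‖wt - η • g i wt - wstar‖ ^ 2 ≤
      ∑ i ∈ G, p i * (‖wt - wstar‖ ^ 2
        - 2 * η * (1 - η * L) * ⟪g i wt - g i wstar, wt - wstar⟫
        - 2 * η * ⟪wt - wstar, g i wstar⟫ + 2 * η ^ 2 * ‖g i wstar‖ ^ 2) :=
    sum_le_sum fun i _ => mul_le_mul_of_nonneg_left
      ((hconv i).norm_gradient_step_sq_le_of_lipschitz_gradient (hdiff i) hLpos (hLipL i)
        η wt wstar) (hp i)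
  have hbad : ∑ j ∈ O, p j * ‖wt - η • g j wt - wstar‖ ^ 2 ≤
      ∑ j ∈ O, p j * (‖wt - wstar‖ ^ 2 + η ^ 2 * ‖g j wt‖ ^ 2
        + 2 * η * (f j wstar - f j wt)) :=
    sum_le_sum fun j _ => mul_le_mul_of_nonneg_left
      ((hconv j).norm_gradient_step_sq_le (hdiff j) hη0.le wt wstar) (hp j)
  have hpmin0 : 0 ≤ pmin := by
    obtain ⟨i, -, rfl⟩ := hpmin.1
    exact hp i
  have hmono : pmin * (lamg * ‖wt - wstar‖ ^ 2) ≤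
      ∑ i ∈ G, p i * ⟪g i wt - g i wstar, wt - wstar⟫ := by
    refine (mul_le_mul_of_nonneg_left (hsc wt wstar) hpmin0).trans ?_
    rw [sum_inner, mul_sum]
    refine sum_le_sum fun i hi => mul_le_mul_of_nonneg_right
      (hpmin.2 (Set.mem_image_of_mem p hi)) ?_
    exact nonneg_of_mul_nonneg_right ((sq_nonneg _).trans
      ((hconv i).sq_norm_sub_le_mul_inner_of_lipschitz_gradient (hdiff i) hLpos (hLipL i)
        wt wstar)) hLpos
  have hcontract := mul_le_mul_of_nonneg_left hmono
    (mul_nonneg (mul_nonneg zero_le_two hη0.le) hstep)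
  have hgood_eq : ∑ i ∈ G, p i * (‖wt - wstar‖ ^ 2
        - 2 * η * (1 - η * L) * ⟪g i wt - g i wstar, wt - wstar⟫
        - 2 * η * ⟪wt - wstar, g i wstar⟫ + 2 * η ^ 2 * ‖g i wstar‖ ^ 2) =
      (∑ i ∈ G, p i) * ‖wt - wstar‖ ^ 2
        - 2 * η * (1 - η * L) * ∑ i ∈ G, p i * ⟪g i wt - g i wstar, wt - wstar⟫
        - 2 * η * ∑ i ∈ G, p i * ⟪wt - wstar, g i wstar⟫
        + 2 * η ^ 2 * ∑ i ∈ G, p i * ‖g i wstar‖ ^ 2 := by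
    simp only [sum_mul, mul_sum, ← sum_sub_distrib, ← sum_add_distrib]
    exact sum_congr rfl fun i _ => by ring
  have hbad_eq : ∑ j ∈ O, p j * (‖wt - wstar‖ ^ 2 + η ^ 2 * ‖g j wt‖ ^ 2
        + 2 * η * (f j wstar - f j wt)) =
      (∑ j ∈ O, p j) * ‖wt - wstar‖ ^ 2 + η ^ 2 * ∑ j ∈ O, p j * ‖g j wt‖ ^ 2
        + 2 * η * ∑ j ∈ O, p j * (f j wstar - f j wt) := by
    simp only [sum_mul, mul_sum, ← sum_add_distrib]
    exact sum_congr rfl fun j _ => by ring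
  have hone : (∑ i ∈ G, p i) * ‖wt - wstar‖ ^ 2 + (∑ j ∈ O, p j) * ‖wt - wstar‖ ^ 2 =
      ‖wt - wstar‖ ^ 2 := by
    rw [← add_mul, ← hsplit, hpsum, one_mul]
  rw [hsplit]
  linarith
end

section
/- Let E be a real inner product space and let f₁, …, fₙ : E → ℝ be convex differentiable functions such that each ∇fᵢ is Lᵢ-Lipschitz; set L := maxᵢ Lᵢ. Suppose the average F(w) = (1/n)Σᵢ fᵢ(w) is λ-strongly convex (⟨∇F(w) − ∇F(v), w − v⟩ ≥ λ‖w − v‖²) with λ > 0 and ∇F(w*) = 0. Set σ² := (1/n) Σᵢ ‖∇fᵢ(w*)‖². Then for any w ∈ E and stepsize 0 < η ≤ 1/L, the expected squared distance after one uniform-SGD step satisfies (1/n) Σᵢ₌₁ⁿ ‖w − η∇fᵢ(w) − w*‖² ≤ (1 − 2ηλ(1 − ηL)) ‖w − w*‖² + 2η²σ². -/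
open RealInnerProductSpace Finset

section Smooth

variable {E : Type*} [NormedAddCommGroup E] [InnerProductSpace ℝ E] {f : E → ℝ} {g : E → E}

/-- Derivative of a function with gradient `g` along the line `t ↦ x + t • d`. -/
lemma hasDerivAt_comp_line (hdiff : ∀ w, HasFDerivAt f (innerSL ℝ (g w)) w) (x d : E) (t : ℝ) :
    HasDerivAt (fun t : ℝ => f (x + t • d)) ⟪g (x + t • d), d⟫ t := by
  have hline : HasDerivAt (fun t : ℝ => x + t • d) d t := by
    simpa using ((hasDerivAt_id t).smul_const d).const_add x
  exact (hdiff (x + t • d)).comp_hasDerivAt t hline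

/-- First-order characterization of convexity: the graph lies above its tangents. -/
lemma ConvexOn.add_inner_gradient_le (hconv : ConvexOn ℝ Set.univ f)
    (hdiff : ∀ w, HasFDerivAt f (innerSL ℝ (g w)) w) (x d : E) :
    f x + ⟪g x, d⟫ ≤ f (x + d) := by
  have hline : ConvexOn ℝ Set.univ (fun t : ℝ => f (x + t • d)) := by
    have h := hconv.comp_affineMap (AffineMap.lineMap x (x + d) : ℝ →ᵃ[ℝ] E)
    simpa [Function.comp_def, AffineMap.lineMap_apply, add_comm] using h
  have h := hline.le_slope_of_hasDerivAt (Set.mem_univ 0) (Set.mem_univ 1) zero_lt_one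
    (hasDerivAt_comp_line hdiff x d 0)
  simp [slope_def_field] at h
  linarith

/-- The quadratic upper bound (descent lemma) for a function with Lipschitz gradient. -/
lemma le_add_inner_gradient_add_sq (hdiff : ∀ w, HasFDerivAt f (innerSL ℝ (g w)) w)
    {L : ℝ} (hLip : ∀ w v, ‖g w - g v‖ ≤ L * ‖w - v‖) (x d : E) :
    f (x + d) ≤ f x + ⟪g x, d⟫ + L / 2 * ‖d‖ ^ 2 := by
  have hderiv (t : ℝ) : HasDerivAt
      (fun t : ℝ => f (x + t • d) - t * ⟪g x, d⟫ - t ^ 2 * (L / 2 * ‖d‖ ^ 2))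
      (⟪g (x + t • d), d⟫ - ⟪g x, d⟫ - 2 * t * (L / 2 * ‖d‖ ^ 2)) t := by
    refine (((hasDerivAt_comp_line hdiff x d t).sub
      ((hasDerivAt_id t).mul_const ⟪g x, d⟫)).sub
      ((hasDerivAt_pow 2 t).mul_const (L / 2 * ‖d‖ ^ 2))).congr_deriv ?_
    simp
  have hanti := antitoneOn_of_deriv_nonpos (convex_Ici (0 : ℝ))
    (fun t _ => (hderiv t).continuousAt.continuousWithinAt)
    (fun t _ => (hderiv t).differentiableAt.differentiableWithinAt)
    (fun t ht => by
      rw [interior_Ici, Set.mem_Ioi] at ht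
      rw [(hderiv t).deriv, ← inner_sub_left]
      have hgrad : ‖g (x + t • d) - g x‖ ≤ L * (t * ‖d‖) := by
        simpa [norm_smul, abs_of_pos ht] using hLip (x + t • d) x
      have hmul := mul_le_mul_of_nonneg_right hgrad (norm_nonneg d)
      linarith [real_inner_le_norm (g (x + t • d) - g x) d])
  have h := hanti Set.self_mem_Ici (Set.mem_Ici.2 zero_le_one) zero_le_one
  simp at h
  linarith

/-- The linearization error of a convex function with Lipschitz gradient dominates the squared
change of the gradient. -/
lemma ConvexOn.sq_norm_gradient_sub_le (hconv : ConvexOn ℝ Set.univ f)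
    (hdiff : ∀ w, HasFDerivAt f (innerSL ℝ (g w)) w)
    {L : ℝ} (hL : 0 < L) (hLip : ∀ w v, ‖g w - g v‖ ≤ L * ‖w - v‖) (x y : E) :
    ‖g x - g y‖ ^ 2 ≤ 2 * L * (f x - f y - ⟪g y, x - y⟫) := by
  have hlow := hconv.add_inner_gradient_le hdiff y (x - y + -(L⁻¹ • (g x - g y)))
  have hupp := le_add_inner_gradient_add_sq hdiff hLip x (-(L⁻¹ • (g x - g y)))
  rw [show y + (x - y + -(L⁻¹ • (g x - g y))) = x + -(L⁻¹ • (g x - g y)) by abel,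
    inner_add_right, inner_neg_right, real_inner_smul_right] at hlow
  rw [inner_neg_right, real_inner_smul_right, norm_neg, norm_smul, mul_pow, Real.norm_eq_abs,
    sq_abs] at hupp
  have hsq : ⟪g x, g x - g y⟫ - ⟪g y, g x - g y⟫ = ‖g x - g y‖ ^ 2 := by
    rw [← inner_sub_left, real_inner_self_eq_norm_sq]
  have key : L⁻¹ * ‖g x - g y‖ ^ 2 - L / 2 * (L⁻¹ ^ 2 * ‖g x - g y‖ ^ 2) ≤
      f x - f y - ⟪g y, x - y⟫ := by
    rw [← hsq] at hupp ⊢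
    linarith
  calc ‖g x - g y‖ ^ 2
      = 2 * L * (L⁻¹ * ‖g x - g y‖ ^ 2 - L / 2 * (L⁻¹ ^ 2 * ‖g x - g y‖ ^ 2)) := by
        field_simp
        ring
    _ ≤ _ := by gcongr

/-- Cocoercivity of the gradient (Baillon–Haddad). -/
lemma ConvexOn.gradient_cocoercive (hconv : ConvexOn ℝ Set.univ f)
    (hdiff : ∀ w, HasFDerivAt f (innerSL ℝ (g w)) w)
    {L : ℝ} (hL : 0 < L) (hLip : ∀ w v, ‖g w - g v‖ ≤ L * ‖w - v‖) (x y : E) :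
    ‖g x - g y‖ ^ 2 ≤ L * ⟪g x - g y, x - y⟫ := by
  have hxy := hconv.sq_norm_gradient_sub_le hdiff hL hLip x y
  have hyx := hconv.sq_norm_gradient_sub_le hdiff hL hLip y x
  rw [norm_sub_rev, ← neg_sub x y, inner_neg_right] at hyx
  rw [inner_sub_left]
  linarith

/-- Expansion of the squared distance to `v` after one gradient step from `w`. -/
lemma ConvexOn.sq_norm_gradient_step_le (hconv : ConvexOn ℝ Set.univ f)
    (hdiff : ∀ w, HasFDerivAt f (innerSL ℝ (g w)) w)
    {L : ℝ} (hL : 0 < L) (hLip : ∀ w v, ‖g w - g v‖ ≤ L * ‖w - v‖) (w v : E) (η : ℝ) :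
    ‖w - η • g w - v‖ ^ 2 ≤ ‖w - v‖ ^ 2 - 2 * η * ⟪g w, w - v⟫ +
      2 * η ^ 2 * (L * ⟪g w - g v, w - v⟫ + ‖g v‖ ^ 2) := by
  have hpar := parallelogram_law_with_norm ℝ (g w - g v) (g v)
  rw [sub_add_cancel] at hpar
  have hgrad : ‖g w‖ ^ 2 ≤ 2 * (L * ⟪g w - g v, w - v⟫ + ‖g v‖ ^ 2) := by
    linarith [hconv.gradient_cocoercive hdiff hL hLip w v, sq_nonneg ‖g w - g v - g v‖]
  rw [show w - η • g w - v = (w - v) - η • g w by abel, norm_sub_sq_real, real_inner_smul_right,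
    real_inner_comm, norm_smul, mul_pow, Real.norm_eq_abs, sq_abs]
  linarith [mul_le_mul_of_nonneg_left hgrad (sq_nonneg η)]

end Smooth

/-- One-step contraction for uniform SGD with strongly convex average loss
(underlying Lemma 5 of the paper, after Needell–Srebro–Ward). -/
theorem sgd_one_step_contraction
    {E : Type*} [NormedAddCommGroup E] [InnerProductSpace ℝ E]
    (n : ℕ) (hn : 1 ≤ n)
    (f : Fin n → E → ℝ) (g : Fin n → E → E)
    (hconv : ∀ i, ConvexOn ℝ Set.univ (f i))
    (hdiff : ∀ i w, HasFDerivAt (f i) ((innerSL ℝ) (g i w)) w)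
    (Li : Fin n → ℝ)
    (hLip : ∀ i, ∀ w v : E, ‖g i w - g i v‖ ≤ Li i * ‖w - v‖)
    (L : ℝ) (hL : IsGreatest (Set.range Li) L)
    (lam : ℝ) (hlam : 0 < lam)
    (hsc : ∀ w v : E,
      ⟪(n : ℝ)⁻¹ • (∑ i, g i w) - (n : ℝ)⁻¹ • (∑ i, g i v), w - v⟫ ≥
        lam * ‖w - v‖ ^ 2)
    (wstar : E) (hstar : (n : ℝ)⁻¹ • (∑ i, g i wstar) = 0)
    (σsq : ℝ) (hσ : σsq = (n : ℝ)⁻¹ * ∑ i, ‖g i wstar‖ ^ 2)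
    (w : E) (η : ℝ) (hη0 : 0 < η) (hηL : η ≤ 1 / L) :
    (n : ℝ)⁻¹ * (∑ i, ‖w - η • g i w - wstar‖ ^ 2) ≤
      (1 - 2 * η * lam * (1 - η * L)) * ‖w - wstar‖ ^ 2 + 2 * η ^ 2 * σsq := by
  have hLpos : 0 < L := one_div_pos.1 (hη0.trans_le hηL)
  have hstep : 0 ≤ 1 - η * L := by
    linarith [(le_div_iff₀ hLpos).1 hηL]
  have hn0 : (n : ℝ) ≠ 0 := by positivity
  have hmean := hsc w wstar
  rw [hstar, sub_zero, real_inner_smul_left, sum_inner] at hmean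
  have hzero : (n : ℝ)⁻¹ * ∑ i, ⟪g i wstar, w - wstar⟫ = 0 := by
    rw [← sum_inner, ← real_inner_smul_left, hstar, inner_zero_left]
  calc (n : ℝ)⁻¹ * ∑ i, ‖w - η • g i w - wstar‖ ^ 2
      ≤ (n : ℝ)⁻¹ * ∑ i, (‖w - wstar‖ ^ 2 - 2 * η * ⟪g i w, w - wstar⟫ +
          2 * η ^ 2 * (L * ⟪g i w - g i wstar, w - wstar⟫ + ‖g i wstar‖ ^ 2)) := by
        gcongr with i
        refine (hconv i).sq_norm_gradient_step_le (hdiff i) hLpos (fun x y => ?_) w wstar η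
        exact (hLip i x y).trans (by gcongr; exact hL.2 ⟨i, rfl⟩)
    _ = ‖w - wstar‖ ^ 2 - 2 * η * (1 - η * L) * ((n : ℝ)⁻¹ * ∑ i, ⟪g i w, w - wstar⟫) -
          2 * η ^ 2 * L * ((n : ℝ)⁻¹ * ∑ i, ⟪g i wstar, w - wstar⟫) + 2 * η ^ 2 * σsq := by
        simp only [inner_sub_left, sum_add_distrib, sum_sub_distrib, ← mul_sum, sum_const,
          card_univ, Fintype.card_fin, nsmul_eq_mul, hσ]
        field_simp
        ring
    _ ≤ _ := by
        rw [hzero]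
        linarith [mul_le_mul_of_nonneg_left hmean (by positivity : 0 ≤ 2 * η * (1 - η * L))]
end
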